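/- Let k ≥ 2 and n ≥ 3 be integers. The coefficient of x^{(k−1)(n−1)−k} (the second-highest occurring power of x) in the k-generalized Fibonacci polynomial 𝓕_{n,k}(x) equals n − 2. -/

import Mathlib

open Polynomial

section Helpers

variable (k : ℕ) (hk : 2 ≤ k) (F : ℤ → Polynomial ℤ)

theorem fib_aux_coeff
    (hrec : ∀ n : ℤ, F n = ∑ i ∈ Finset.range k, X ^ (k - 1 - i) * F (n - 1 - (i : ℤ)))
    (n : ℤ) (j : ℕ) :
    (F n).coeff j = ∑ i ∈ Finset.range k,
      if k - 1 - i ≤ j then (F (n - 1 - (i : ℤ))).coeff (j - (k - 1 - i)) else 0 := by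
  rw [hrec n, finset_sum_coeff]
  exact Finset.sum_congr rfl fun i _ => coeff_X_pow_mul' _ _ _

theorem fib_aux_zero (hk : 2 ≤ k)
    (hrec : ∀ n : ℤ, F n = ∑ i ∈ Finset.range k, X ^ (k - 1 - i) * F (n - 1 - (i : ℤ)))
    (hF1 : F 1 = 1)
    (hF0 : ∀ m : ℕ, m ≤ k - 2 → F (-(m : ℤ)) = 0) (N : ℕ) :
    ∀ m : ℤ, 2 - (k : ℤ) ≤ m → m ≤ N → ∀ j : ℕ, (k : ℤ) * (m - 1) < j + (m - 1) →
      (F m).coeff j = 0 := by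
  induction N with
  | zero =>
    intro m h1 h2 j _
    have := hF0 (-m).toNat (by omega)
    rw [show -(((-m).toNat : ℕ) : ℤ) = m by push_cast at h2; omega] at this
    simp [this]
  | succ N ih =>
    intro m h1 h2 j hj
    by_cases hm : m ≤ N
    · exact ih m h1 hm j hj
    have hm' : m = N + 1 := by push_cast at h2; omega
    by_cases hN : N = 0
    · subst hN
      have : m = 1 := by simpa using hm'
      subst this
      rw [hF1, coeff_one, if_neg]
      rintro rfl
      simp at hj
    rw [fib_aux_coeff k F hrec]
    refine Finset.sum_eq_zero fun i hi => ?_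
    have hi := Finset.mem_range.1 hi
    split_ifs with h
    · apply ih _ (by omega) (by omega)
      have e : ((j - (k - 1 - i) : ℕ) : ℤ) = j - (k - 1 - i) := by omega
      rw [e]
      nlinarith
    · rfl

theorem fib_aux_top (hk : 2 ≤ k)
    (hrec : ∀ n : ℤ, F n = ∑ i ∈ Finset.range k, X ^ (k - 1 - i) * F (n - 1 - (i : ℤ)))
    (hF1 : F 1 = 1)
    (hF0 : ∀ m : ℕ, m ≤ k - 2 → F (-(m : ℤ)) = 0) (N : ℕ) :
    ∀ j : ℕ, (k : ℤ) * N = j + N → (F (N + 1)).coeff j = 1 := by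
  induction N with
  | zero =>
    intro j hj
    have : j = 0 := by simpa using hj.symm
    subst this
    simp [hF1]
  | succ N ih =>
    intro j hj
    push_cast at hj
    rw [fib_aux_coeff k F hrec, Finset.sum_eq_single_of_mem 0 (by simp; omega)]
    · have hle : k - 1 - 0 ≤ j := by zify [show 1 ≤ k by omega]; simp; nlinarith
      rw [if_pos hle]
      have := ih (j - (k - 1 - 0)) (by
        have e : ((j - (k - 1 - 0) : ℕ) : ℤ) = j - (k - 1) := by omega
        rw [e]; linarith)
      simpa using this
    · intro i hi hi0
      have hi := Finset.mem_range.1 hi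
      split_ifs with h
      · apply fib_aux_zero k F hk hrec hF1 hF0 N _ (by omega) (by omega)
        have e : ((j - (k - 1 - i) : ℕ) : ℤ) = j - (k - 1 - i) := by omega
        rw [e]
        have : (1 : ℤ) ≤ i := by omega
        push_cast
        nlinarith
      · rfl

theorem fib_aux_second (hk : 2 ≤ k)
    (hrec : ∀ n : ℤ, F n = ∑ i ∈ Finset.range k, X ^ (k - 1 - i) * F (n - 1 - (i : ℤ)))
    (hF1 : F 1 = 1)
    (hF0 : ∀ m : ℕ, m ≤ k - 2 → F (-(m : ℤ)) = 0) (N : ℕ) :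
    ∀ j : ℕ, (k : ℤ) * (N + 1) = j + (N + 2) → (F (N + 3)).coeff j = N + 1 := by
  induction N with
  | zero =>
    intro j hj
    simp at hj
    rw [fib_aux_coeff k F hrec, Finset.sum_eq_single_of_mem 1 (by simp; omega)]
    · have e : j - (k - 1 - 1) = 0 := by omega
      rw [if_pos (by omega), e]
      simp [hF1]
    · intro i hi hi0
      have hi := Finset.mem_range.1 hi
      split_ifs with h
      · apply fib_aux_zero k F hk hrec hF1 hF0 2 _ (by omega) (by omega)
        have e : ((j - (k - 1 - i) : ℕ) : ℤ) = j - (k - 1 - i) := by omega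
        rw [e]
        have : (2 : ℤ) ≤ i := by omega
        push_cast
        nlinarith
      · rfl
  | succ N ih =>
    intro j hj
    push_cast at hj
    have hle : k - 1 ≤ j := by zify [show 1 ≤ k by omega]; nlinarith
    rw [fib_aux_coeff k F hrec, ← Finset.sum_subset (s₁ := {0, 1})]
    · rw [Finset.sum_pair (by simp), if_pos (by omega), if_pos (by omega)]
      have h0 := ih (j - (k - 1 - 0)) (by
        have e : ((j - (k - 1 - 0) : ℕ) : ℤ) = j - (k - 1) := by omega
        rw [e]; linarith)
      have h1 := fib_aux_top k F hk hrec hF1 hF0 (N + 1) (j - (k - 1 - 1)) (by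
        have e : ((j - (k - 1 - 1) : ℕ) : ℤ) = j - (k - 2) := by omega
        rw [e]; push_cast; linarith)
      have e0 : ((N + 1 : ℕ) : ℤ) + 3 - 1 - ((0 : ℕ) : ℤ) = N + 3 := by push_cast; ring
      have e1 : ((N + 1 : ℕ) : ℤ) + 3 - 1 - ((1 : ℕ) : ℤ) = ((N + 1 : ℕ) : ℤ) + 1 := by
        push_cast; ring
      rw [e0, e1, h0, h1]
      push_cast; ring
    · intro i hi
      simp at hi ⊢
      omega
    · intro i hi hi0
      have hi := Finset.mem_range.1 hi
      simp at hi0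
      split_ifs with h
      · apply fib_aux_zero k F hk hrec hF1 hF0 (N + 3) _ (by omega) (by omega)
        have e : ((j - (k - 1 - i) : ℕ) : ℤ) = j - (k - 1 - i) := by omega
        rw [e]
        have : (2 : ℤ) ≤ i := by omega
        push_cast
        nlinarith
      · rfl

end Helpers

/-- For `k ≥ 2` and `n ≥ 3`, the coefficient of `x^((k-1)(n-1) - k)`
(the second-highest occurring power) in the `k`-generalized Fibonacci polynomial equals `n - 2`. -/
theorem fib_poly_second_highest_coeff_pos (k : ℕ) (hk : 2 ≤ k)
    (F : ℤ → Polynomial ℤ)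
    (hrec : ∀ n : ℤ, F n = ∑ i ∈ Finset.range k, X ^ (k - 1 - i) * F (n - 1 - (i : ℤ)))
    (hF1 : F 1 = 1)
    (hF0 : ∀ m : ℕ, m ≤ k - 2 → F (-(m : ℤ)) = 0)
    (n : ℕ) (hn : 3 ≤ n) :
    (F (n : ℤ)).coeff ((k - 1) * (n - 1) - k) = (n : ℤ) - 2 := by
  obtain ⟨N, rfl⟩ : ∃ N, n = N + 3 := ⟨n - 3, by omega⟩
  obtain ⟨l, rfl⟩ : ∃ l, k = l + 2 := ⟨k - 2, by omega⟩
  have e : (l + 2 - 1) * (N + 3 - 1) - (l + 2) = l * N + l + N := by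
    simp only [show l + 2 - 1 = l + 1 by omega, show N + 3 - 1 = N + 2 by omega]
    rw [show (l + 1) * (N + 2) = l * N + l + N + (l + 2) by ring]
    omega
  rw [e]
  have := fib_aux_second (l + 2) F hk hrec hF1 hF0 N (l * N + l + N) (by push_cast; ring)
  push_cast
  rw [this]
  ring
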